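/- For b ∈ k one has F(M_b) = V(M_b) if and only if b^{p²} = b. (Equivalently, the Dieudonné module M_b is superspecial, i.e. F²(M_b) = p·M_b, precisely when the corresponding point [1 : b] of the projective line is 𝔽_{p²}-rational.) -/

import Mathlib

/-!
Common setup: `p` a prime, `k` an algebraically closed field of characteristic `p`,
`W = W(k)` the ring of `p`-typical Witt vectors, `σ` the Witt vector Frobenius,
`ρ : W → k` reduction (0-th coefficient), `N = W⁴` with the semilinear maps `F`, `V`,
the Gram matrix `J'` of the alternating form, the Dieudonné submodules `M_b`, and the
coordinate map `q` for `N/V(N)`.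
-/

noncomputable section

open WittVector Matrix

variable (p : ℕ) [Fact p.Prime] (k : Type) [Field k] [IsAlgClosed k] [CharP k p]

/-- The reduction map `ρ : W(k) → k` sending a Witt vector to its 0-th coefficient. -/
def redW : WittVector p k →+* k where
  toFun x := x.coeff 0
  map_one' := WittVector.one_coeff_zero p k
  map_mul' := WittVector.mul_coeff_zero
  map_zero' := WittVector.zero_coeff p k 0
  map_add' := WittVector.add_coeff_zero

/-- The Witt vector Frobenius `σ`, a ring automorphism of `W(k)` since `k` is perfect. -/
def sigmaW : WittVector p k ≃+* WittVector p k := WittVector.frobeniusEquiv p k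

/-- The standard basis vectors `e₁, e₂, e₃, e₄` of `N = W⁴` (0-indexed). -/
def eW (i : Fin 4) : Fin 4 → WittVector p k := Pi.single i 1

/-- The `σ`-semilinear map `F : N → N` with `F e₁ = e₂`, `F e₂ = -p e₁`,
`F e₃ = e₄`, `F e₄ = -p e₃`. -/
def Fmap : (Fin 4 → WittVector p k) → (Fin 4 → WittVector p k) := fun x =>
  ![-(p : WittVector p k) * sigmaW p k (x 1), sigmaW p k (x 0),
    -(p : WittVector p k) * sigmaW p k (x 3), sigmaW p k (x 2)]

/-- The `σ⁻¹`-semilinear map `V : N → N` with `V e₁ = -e₂`, `V e₂ = p e₁`,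
`V e₃ = -e₄`, `V e₄ = p e₃`. -/
def Vmap : (Fin 4 → WittVector p k) → (Fin 4 → WittVector p k) := fun x =>
  ![(p : WittVector p k) * (sigmaW p k).symm (x 1), -(sigmaW p k).symm (x 0),
    (p : WittVector p k) * (sigmaW p k).symm (x 3), -(sigmaW p k).symm (x 2)]

/-- The Gram matrix `J'` of the alternating form `⟨ , ⟩` on `N` with
`⟨e₁,e₃⟩ = 1 = -⟨e₃,e₁⟩`, `⟨e₂,e₄⟩ = p = -⟨e₄,e₂⟩`. -/
def Jmat : Matrix (Fin 4) (Fin 4) (WittVector p k) :=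
  !![0, 0, 1, 0;
     0, 0, 0, (p : WittVector p k);
     -1, 0, 0, 0;
     0, -(p : WittVector p k), 0, 0]

/-- The `W`-linear endomorphism of `N` with matrix `A` commutes with `F`. -/
def CommF (A : Matrix (Fin 4) (Fin 4) (WittVector p k)) : Prop :=
  ∀ x, A.mulVec (Fmap p k x) = Fmap p k (A.mulVec x)

/-- The `W`-submodule `M_b` of `N` spanned by `p e₁, p e₃, e₂, e₄` and `e₁ + b̃ e₃`,
where `b̃` is the Teichmüller lift of `b` (a lift of `b` under `ρ`). -/
def Mmod (b : k) : Submodule (WittVector p k) (Fin 4 → WittVector p k) :=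
  Submodule.span (WittVector p k)
    {(p : WittVector p k) • eW p k 0, (p : WittVector p k) • eW p k 2, eW p k 1, eW p k 3,
     eW p k 0 + WittVector.teichmuller p b • eW p k 2}

/-- Coordinates of the class of `x ∈ N` in `N/V(N) ≃ k²` with respect to the basis given
by the classes of `e₁` and `e₃`. -/
def qmap : (Fin 4 → WittVector p k) → (Fin 2 → k) := fun x => ![redW p k (x 0), redW p k (x 2)]

theorem redW_sigmaW (x : WittVector p k) : redW p k (sigmaW p k x) = redW p k x ^ p :=
  WittVector.coeff_frobenius_charP p x 0

theorem redW_sigmaW_symm_pow (x : WittVector p k) :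
    redW p k ((sigmaW p k).symm x) ^ p = redW p k x := by
  rw [← redW_sigmaW, RingEquiv.apply_symm_apply]

theorem redW_teichmuller (b : k) : redW p k (WittVector.teichmuller p b) = b :=
  WittVector.teichmuller_coeff_zero p b

theorem redW_eq_zero_iff_dvd (x : WittVector p k) :
    redW p k x = 0 ↔ (p : WittVector p k) ∣ x := by
  rw [← Ideal.mem_span_singleton, ← WittVector.ker_constantCoeff, RingHom.mem_ker]
  rfl

/-- `M_b` is the preimage under `q` of the line spanned by `(1, b)`. -/
theorem mem_Mmod_iff (b : k) (x : Fin 4 → WittVector p k) :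
    x ∈ Mmod p k b ↔ redW p k (x 2) = b * redW p k (x 0) := by
  constructor
  · intro h
    induction h using Submodule.span_induction with
    | mem y hy =>
      simp only [Set.mem_insert_iff, Set.mem_singleton_iff] at hy
      rcases hy with rfl | rfl | rfl | rfl | rfl <;>
        simp [eW, redW_teichmuller]
    | zero => simp
    | add y z _ _ hy hz => simp [hy, hz, mul_add]
    | smul a y _ hy => simp [hy, mul_left_comm]
  · intro h
    obtain ⟨c, hc⟩ : (p : WittVector p k) ∣ x 2 - x 0 * WittVector.teichmuller p b := by
      rw [← redW_eq_zero_iff_dvd, map_sub, map_mul, redW_teichmuller, h]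
      ring
    have hx : x = x 0 • (eW p k 0 + WittVector.teichmuller p b • eW p k 2) +
        c • ((p : WittVector p k) • eW p k 2) + x 1 • eW p k 1 + x 3 • eW p k 3 := by
      funext i
      fin_cases i
      · simp [eW]
      · simp [eW]
      · simp [eW]
        linear_combination hc
      · simp [eW]
    rw [hx]
    refine add_mem (add_mem (add_mem ?_ ?_) ?_) ?_ <;>
      exact Submodule.smul_mem _ _ (Submodule.subset_span (by simp))

theorem mem_Fmap_image_Mmod_iff (b : k) (y : Fin 4 → WittVector p k) :
    y ∈ Fmap p k '' (Mmod p k b : Set (Fin 4 → WittVector p k)) ↔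
      (p : WittVector p k) ∣ y 0 ∧ (p : WittVector p k) ∣ y 2 ∧
        redW p k (y 3) = b ^ p * redW p k (y 1) := by
  constructor
  · rintro ⟨x, hx, rfl⟩
    rw [SetLike.mem_coe, mem_Mmod_iff] at hx
    simp [Fmap, redW_sigmaW, hx, mul_pow]
  · rintro ⟨⟨u, hu⟩, ⟨v, hv⟩, h⟩
    refine ⟨![(sigmaW p k).symm (y 1), -(sigmaW p k).symm u,
      (sigmaW p k).symm (y 3), -(sigmaW p k).symm v], ?_, ?_⟩
    · rw [SetLike.mem_coe, mem_Mmod_iff]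
      apply frobenius_inj k p
      simpa [frobenius_def, mul_pow, redW_sigmaW_symm_pow] using h
    · funext i
      fin_cases i <;> simp [Fmap, hu, hv]

theorem mem_Vmap_image_Mmod_iff (b : k) (y : Fin 4 → WittVector p k) :
    y ∈ Vmap p k '' (Mmod p k b : Set (Fin 4 → WittVector p k)) ↔
      (p : WittVector p k) ∣ y 0 ∧ (p : WittVector p k) ∣ y 2 ∧
        redW p k (y 3) ^ p = b * redW p k (y 1) ^ p := by
  constructor
  · rintro ⟨x, hx, rfl⟩
    rw [SetLike.mem_coe, mem_Mmod_iff] at hx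
    refine ⟨by simp [Vmap], by simp [Vmap], ?_⟩
    simp [Vmap, ← map_neg, redW_sigmaW_symm_pow]
    simp [hx]
  · rintro ⟨⟨u, hu⟩, ⟨v, hv⟩, h⟩
    refine ⟨![-sigmaW p k (y 1), sigmaW p k u, -sigmaW p k (y 3), sigmaW p k v], ?_, ?_⟩
    · rw [SetLike.mem_coe, mem_Mmod_iff]
      simp [redW_sigmaW, h]
    · funext i
      fin_cases i <;> simp [Vmap, hu, hv]

/-- `F(M_b) = V(M_b)` iff `b^{p²} = b`, i.e. `M_b` is superspecial exactly
when `[1 : b]` is `𝔽_{p²}`-rational. -/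
theorem F_image_eq_V_image_iff
    (b : k) :
    Fmap p k '' (Mmod p k b : Set (Fin 4 → WittVector p k)) =
      Vmap p k '' (Mmod p k b : Set (Fin 4 → WittVector p k)) ↔
    b ^ p ^ 2 = b := by
  constructor
  · intro h
    have hF : ![0, 1, 0, WittVector.teichmuller p (b ^ p)] ∈
        Fmap p k '' (Mmod p k b : Set (Fin 4 → WittVector p k)) := by
      rw [mem_Fmap_image_Mmod_iff]
      simp [redW_teichmuller, -map_pow]
    rw [h, mem_Vmap_image_Mmod_iff] at hF
    simpa [redW_teichmuller, -map_pow, ← pow_mul, ← sq] using hF.2.2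
  · intro hb
    ext y
    rw [mem_Fmap_image_Mmod_iff, mem_Vmap_image_Mmod_iff, ← (frobenius_inj k p).eq_iff]
    simp only [frobenius_def, mul_pow, ← pow_mul, ← sq, hb]

end
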